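/- arXiv:2405.16515 — 2 statements merged into one kernel-verified Lean document; each statement's English description precedes it below -/
import Mathlib

section
/- For every dimension d ≥ 1, optimally-adaptive estimators of the L₂-norm of a density do not exist over the collection {𝓕_ϑ}: there is no sequence (N̂_n) of estimators (N̂_n a Borel-measurable function (ℝ^d)^n → ℝ) such that for every ϑ = (β⃗, r⃗, q, L⃗, Q) ∈ (0,∞)^d × [1,∞]^d × [2,∞] × (0,∞)^d × (0,∞) one has limsup_{n→∞} n^{z(β⃗,r⃗,q)} · sup_{f ∈ 𝓕_ϑ} ( E_f[(N̂_n(X^{(n)}) − ‖f‖₂)²] )^{1/2} < ∞. -/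
open MeasureTheory ENNReal Filter

noncomputable section

/-- The `k_j`-th order difference operator in direction `j` with step `u`. -/
def diffOp (d : ℕ) (u : ℝ) (j : Fin d) (G : (Fin d → ℝ) → ℝ) : (Fin d → ℝ) → ℝ :=
  fun x => G (fun i => x i + if i = j then u else 0) - G x

/-- The anisotropic Nikolskii class `N_{r,d}(β, L)`. -/
def NikolskiiClass (d : ℕ) (β : Fin d → ℝ) (r : Fin d → ℝ≥0∞) (L : Fin d → ℝ) :
    Set ((Fin d → ℝ) → ℝ) :=
  {G | (∀ j, eLpNorm G (r j) volume ≤ ENNReal.ofReal (L j)) ∧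
    ∀ j, ∃ k : ℕ, (β j : ℝ) < k ∧ ∀ u : ℝ,
      eLpNorm ((diffOp d u j)^[k] G) (r j) volume ≤ ENNReal.ofReal (L j * |u| ^ (β j))}

/-- A probability density on `ℝ^d` (w.r.t. Lebesgue measure). -/
def IsDensity (d : ℕ) (f : (Fin d → ℝ) → ℝ) : Prop :=
  Measurable f ∧ (∀ x, 0 ≤ f x) ∧ ∫ x, f x = 1

/-- The class `𝓕_ϑ = N_{r,d}(β,L) ∩ 𝔹_q(Q)` of probability densities. -/
def FClass (d : ℕ) (β : Fin d → ℝ) (r : Fin d → ℝ≥0∞) (q : ℝ≥0∞) (L : Fin d → ℝ)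
    (Q : ℝ) : Set ((Fin d → ℝ) → ℝ) :=
  {f | IsDensity d f ∧ f ∈ NikolskiiClass d β r L ∧ eLpNorm f q volume ≤ ENNReal.ofReal Q}

/-- `1/ω = Σ_j 1/(β_j r_j)` (with `1/∞ = 0`). -/
def invOmega (d : ℕ) (β : Fin d → ℝ) (r : Fin d → ℝ≥0∞) : ℝ :=
  ∑ j, (1 / β j) * ((r j)⁻¹).toReal

/-- `1/β = Σ_j 1/β_j`. -/
def invBeta (d : ℕ) (β : Fin d → ℝ) : ℝ := ∑ j, 1 / β j

/-- `τ(s) = 1 - 1/ω + 1/(β s)` (with `1/∞ = 0`). -/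
def tau (d : ℕ) (β : Fin d → ℝ) (r : Fin d → ℝ≥0∞) (s : ℝ≥0∞) : ℝ :=
  1 - invOmega d β r + invBeta d β * (s⁻¹).toReal

/-- The rate exponent `z(β, r, q)`. -/
def rateExp (d : ℕ) (β : Fin d → ℝ) (r : Fin d → ℝ≥0∞) (q : ℝ≥0∞) : ℝ :=
  if 1 ≤ tau d β r 2 then min (1 / 2) (1 / tau d β r 1)
  else if tau d β r q < 0 then
    (1 - 2 * (q⁻¹).toReal) / (2 - 2 * (q⁻¹).toReal - tau d β r q)
  else min (1 / 2) (tau d β r 2 / tau d β r 1)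

/-- The law `𝐏_f` of the observation `X^{(n)} = (X_1, …, X_n)`: the measure on
`(ℝ^d)^n` with density `∏_{i=1}^n f(x_i)` w.r.t. Lebesgue measure. -/
def jointLaw (d n : ℕ) (f : (Fin d → ℝ) → ℝ) : Measure (Fin n → Fin d → ℝ) :=
  (volume : Measure (Fin n → Fin d → ℝ)).withDensity
    fun x => ENNReal.ofReal (∏ i, f (x i))

/-- The squared risk `E_f[(N̂(X^{(n)}) - ‖f‖₂)²]` of an estimator, as a lower integral. -/
def risk2 (d n : ℕ) (N : (Fin n → Fin d → ℝ) → ℝ) (f : (Fin d → ℝ) → ℝ) : ℝ≥0∞ :=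
  ∫⁻ x, ENNReal.ofReal ((N x - (eLpNorm f 2 volume).toReal) ^ 2) ∂(jointLaw d n f)

end

lemma sm_pointwise {ι X : Type*} [Fintype ι] (B : ι → Set X) (A : Set X) (s : ℝ) (hs : 0 < s) (x : X) :
    ∑ σ, (A ∩ B σ).indicator (1 : X → ℝ≥0∞) x ≤
      ENNReal.ofReal s * ∑ σ, ∑ τ, (B σ ∩ B τ).indicator (1 : X → ℝ≥0∞) x
        + ENNReal.ofReal (1 / (4 * s)) * A.indicator (1 : X → ℝ≥0∞) x := by
  classical
  by_cases hx : x ∈ A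
  · have h1 : ∀ σ, (A ∩ B σ).indicator (1 : X → ℝ≥0∞) x = ENNReal.ofReal (if x ∈ B σ then 1 else 0) := by
      intro σ
      by_cases h : x ∈ B σ <;> simp [Set.indicator, hx, h]
    have h2 : ∀ σ τ, (B σ ∩ B τ).indicator (1 : X → ℝ≥0∞) x
        = ENNReal.ofReal ((if x ∈ B σ then 1 else 0) * (if x ∈ B τ then 1 else 0)) := by
      intro σ τ
      by_cases h : x ∈ B σ <;> by_cases h' : x ∈ B τ <;> simp [Set.indicator, h, h']
    have h0 : ∀ σ, (0:ℝ) ≤ (if x ∈ B σ then 1 else 0) := by intro σ; split_ifs <;> norm_num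
    simp_rw [h1, h2]
    rw [← ENNReal.ofReal_sum_of_nonneg (fun σ _ => h0 σ)]
    have h3 : ∀ σ, ∑ τ, ENNReal.ofReal ((if x ∈ B σ then 1 else 0) * (if x ∈ B τ then 1 else 0))
        = ENNReal.ofReal ((if x ∈ B σ then 1 else 0) * ∑ τ, (if x ∈ B τ then 1 else 0)) := by
      intro σ
      rw [← ENNReal.ofReal_sum_of_nonneg (fun τ _ => mul_nonneg (h0 σ) (h0 τ)), Finset.mul_sum]
    simp_rw [h3]
    have h4 : (0:ℝ) ≤ ∑ τ, (if x ∈ B τ then 1 else 0) := Finset.sum_nonneg (fun τ _ => h0 τ)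
    rw [← ENNReal.ofReal_sum_of_nonneg (fun τ _ => mul_nonneg (h0 τ) h4), ← Finset.sum_mul]
    simp only [Set.indicator, hx, if_true, Pi.one_apply, mul_one]
    set m : ℝ := ∑ τ, (if x ∈ B τ then 1 else 0)
    rw [← ENNReal.ofReal_mul hs.le, ← ENNReal.ofReal_add (by positivity) (by positivity)]
    apply ENNReal.ofReal_le_ofReal
    have : s * (m * m) + 1 / (4 * s) - m = (2 * s * m - 1) ^ 2 / (4 * s) := by
      field_simp; ring
    have : 0 ≤ (2 * s * m - 1) ^ 2 / (4 * s) := by positivity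
    linarith
  · simp [Set.indicator, hx]

lemma sm_measure {ι X : Type*} [Fintype ι] [MeasurableSpace X] (μ : Measure X) (B : ι → Set X)
    (hB : ∀ σ, MeasurableSet (B σ)) (A : Set X) (hA : MeasurableSet A) (s : ℝ) (hs : 0 < s) :
    ∑ σ, μ (A ∩ B σ) ≤
      ENNReal.ofReal s * ∑ σ, ∑ τ, μ (B σ ∩ B τ) + ENNReal.ofReal (1 / (4 * s)) * μ A := by
  have h := lintegral_mono (μ := μ) (fun x => sm_pointwise B A s hs x)
  have m1 : ∀ S : Set X, MeasurableSet S → Measurable (S.indicator (1 : X → ℝ≥0∞)) :=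
    fun S hS => measurable_one.indicator hS
  rw [lintegral_finsetSum _ (fun σ _ => m1 _ (hA.inter (hB σ))),
    lintegral_add_right _ ((m1 _ hA).const_mul _), lintegral_const_mul _ (m1 _ hA),
    lintegral_const_mul _ (Finset.measurable_sum _ (fun σ _ => Finset.measurable_sum _
      (fun τ _ => m1 _ ((hB σ).inter (hB τ))))),
    lintegral_finsetSum _ (fun σ _ => Finset.measurable_sum _
      (fun τ _ => m1 _ ((hB σ).inter (hB τ))))] at h
  have h3 : ∀ σ, ∫⁻ x, ∑ τ, (B σ ∩ B τ).indicator (1 : X → ℝ≥0∞) x ∂μ = ∑ τ, μ (B σ ∩ B τ) := by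
    intro σ
    rw [lintegral_finsetSum _ (fun τ _ => m1 _ ((hB σ).inter (hB τ)))]
    exact Finset.sum_congr rfl fun τ _ => lintegral_indicator_one ((hB σ).inter (hB τ))
  simp_rw [h3] at h
  rw [lintegral_indicator_one hA] at h
  convert h using 2 with σ
  exact (lintegral_indicator_one (hA.inter (hB σ))).symm

/-- Number of agreements. -/
def agree {M : ℕ} (σ τ : Fin M → Bool) : ℕ := (Finset.univ.filter fun i => σ i = τ i).card

lemma count_bound (n M : ℕ) (hM : 0 < M) :
    ∑ σ : Fin M → Bool, ∑ τ : Fin M → Bool, (2 * (agree σ τ : ℝ) / M) ^ n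
      ≤ 4 ^ M * Real.exp ((n : ℝ) ^ 2 / (2 * M)) := by
  have hM' : (0:ℝ) < M := by exact_mod_cast hM
  have key : ∀ σ : Fin M → Bool, ∑ τ : Fin M → Bool, (2 * (agree σ τ : ℝ) / M) ^ n
      ≤ 2 ^ M * Real.exp ((n : ℝ) ^ 2 / (2 * M)) := by
    intro σ
    have h1 : ∀ τ : Fin M → Bool, (2 * (agree σ τ : ℝ) / M) ^ n
        ≤ ∏ i, Real.exp ((n : ℝ) / M * (if σ i = τ i then 1 else -1)) := by
      intro τ
      rw [← Real.exp_sum, ← Finset.mul_sum]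
      have h2 : ∑ i, (if σ i = τ i then (1:ℝ) else -1) = 2 * agree σ τ - M := by
        have : ∀ i, (if σ i = τ i then (1:ℝ) else -1) = 2 * (if σ i = τ i then 1 else 0) - 1 := by
          intro i; split_ifs <;> norm_num
        simp_rw [this]
        rw [Finset.sum_sub_distrib, ← Finset.mul_sum]
        simp [agree]
      rw [h2]
      have h3 : (n : ℝ) / M * (2 * agree σ τ - M) = n * (2 * (agree σ τ : ℝ) / M - 1) := by
        field_simp
      rw [h3, Real.exp_nat_mul]
      apply pow_le_pow_left₀ (by positivity)
      linarith [Real.add_one_le_exp (2 * (agree σ τ : ℝ) / M - 1)]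
    calc _ ≤ ∑ τ : Fin M → Bool, ∏ i, Real.exp ((n : ℝ) / M * (if σ i = τ i then 1 else -1)) :=
          Finset.sum_le_sum fun τ _ => h1 τ
      _ = ∏ i, ∑ b : Bool, Real.exp ((n : ℝ) / M * (if σ i = b then 1 else -1)) := by
          rw [Finset.prod_univ_sum, Fintype.piFinset_univ]
      _ = ∏ i : Fin M, (2 * Real.cosh ((n : ℝ) / M)) := by
          apply Finset.prod_congr rfl
          intro i _
          rw [Real.cosh_eq]
          cases σ i <;> simp <;> ring
      _ = 2 ^ M * (Real.cosh ((n : ℝ) / M)) ^ M := by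
          simp [mul_pow]
      _ ≤ _ := by
          apply mul_le_mul_of_nonneg_left _ (by positivity)
          calc _ ≤ (Real.exp (((n : ℝ) / M) ^ 2 / 2)) ^ M :=
                pow_le_pow_left₀ (Real.cosh_pos _).le (Real.cosh_le_exp_half_sq _) _
            _ = _ := by
                rw [← Real.exp_nat_mul]
                congr 1
                field_simp
  calc _ ≤ ∑ σ : Fin M → Bool, 2 ^ M * Real.exp ((n : ℝ) ^ 2 / (2 * M)) :=
        Finset.sum_le_sum fun σ _ => key σ
    _ = _ := by
        simp only [Finset.sum_const, Finset.card_univ, Fintype.card_pi, Fintype.card_bool,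
          Finset.prod_const, Fintype.card_fin, nsmul_eq_mul]
        push_cast
        rw [← mul_assoc, ← mul_pow]; norm_num

lemma jointLaw_indicator (d n : ℕ) (S : Set (Fin d → ℝ)) (hS : MeasurableSet S) (c : ℝ) (hc : 0 ≤ c) :
    jointLaw d n (S.indicator fun _ => c) =
      (ENNReal.ofReal c ^ n) • (volume : Measure (Fin n → Fin d → ℝ)).restrict (Set.univ.pi fun _ => S) := by
  have hm : MeasurableSet (Set.univ.pi fun _ : Fin n => S) := MeasurableSet.univ_pi fun _ => hS
  have : (fun x : Fin n → Fin d → ℝ => ENNReal.ofReal (∏ i, (S.indicator (fun _ => c)) (x i)))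
      = (Set.univ.pi fun _ : Fin n => S).indicator (fun _ => ENNReal.ofReal c ^ n) := by
    classical
    ext x
    by_cases hx : ∀ i, x i ∈ S
    · have hx' : x ∈ (Set.univ.pi fun _ : Fin n => S) := by simpa using hx
      rw [Set.indicator_of_mem hx', Finset.prod_congr rfl (fun i _ => Set.indicator_of_mem (hx i) _)]
      simp [ENNReal.ofReal_pow hc]
    · have hx' : x ∉ (Set.univ.pi fun _ : Fin n => S) := by simpa using hx
      rw [Set.indicator_of_notMem hx']
      push Not at hx
      obtain ⟨i, hi⟩ := hx
      rw [Finset.prod_eq_zero (Finset.mem_univ i) (Set.indicator_of_notMem hi _)]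
      simp
  rw [jointLaw, this, withDensity_indicator hm, withDensity_const]

lemma norm2_indicator (d : ℕ) (S : Set (Fin d → ℝ)) (hS : MeasurableSet S) (c : ℝ) (hc : 0 < c)
    (hv : volume S = ENNReal.ofReal (1 / c)) :
    (eLpNorm (S.indicator fun _ => c) 2 volume).toReal = √c := by
  rw [eLpNorm_indicator_const hS (by norm_num) (by norm_num), hv, ENNReal.toReal_mul,
    ← ENNReal.toReal_rpow, ENNReal.toReal_ofReal (by positivity)]
  rw [Real.sqrt_eq_rpow]
  simp only [toReal_enorm, Real.norm_eq_abs, abs_of_pos hc, ENNReal.toReal_ofNat]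
  rw [one_div, Real.inv_rpow hc.le]
  have h1 : c ^ ((1:ℝ)/2) * c ^ ((1:ℝ)/2) = c := by
    rw [← Real.rpow_add hc]; norm_num
  have h2 : 0 < c ^ ((1:ℝ)/2) := Real.rpow_pos_of_pos hc _
  rw [mul_inv_eq_iff_eq_mul₀ h2.ne']
  exact h1.symm

lemma core (d n M : ℕ) (hM : 0 < M) (V : ℝ) (hV : 0 < V) (S0 : Set (Fin d → ℝ))
    (S : (Fin M → Bool) → Set (Fin d → ℝ)) (hS0 : MeasurableSet S0) (hS : ∀ σ, MeasurableSet (S σ))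
    (hsub : ∀ σ, S σ ⊆ S0) (hv0 : volume S0 = ENNReal.ofReal V)
    (hv : ∀ σ τ, volume (S σ ∩ S τ) = ENNReal.ofReal (V * agree σ τ / (2 * M)))
    (N : (Fin n → Fin d → ℝ) → ℝ) (hN : Measurable N) (ρ0 ρ1 : ℝ) (h0 : 0 ≤ ρ0) (h1 : 0 ≤ ρ1)
    (hr0 : risk2 d n N (S0.indicator fun _ => 1 / V) ≤ ENNReal.ofReal ρ0)
    (hr1 : ∀ σ, risk2 d n N ((S σ).indicator fun _ => 2 / V) ≤ ENNReal.ofReal ρ1)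
    (hK : 100 * Real.exp ((n : ℝ) ^ 2 / (2 * M)) * V * ρ0 ≤ 1) :
    1 ≤ 50 * V * ρ1 := by
  have hM' : (0:ℝ) < M := by exact_mod_cast hM
  set K := Real.exp ((n : ℝ) ^ 2 / (2 * M)) with hKdef
  have hKpos : 0 < K := Real.exp_pos _
  have hvσ : ∀ σ, volume (S σ) = ENNReal.ofReal (V / 2) := by
    intro σ
    have := hv σ σ
    rw [Set.inter_self] at this
    rw [this]
    congr 1
    simp only [agree, Finset.filter_true, Finset.card_univ, Fintype.card_fin]
    field_simp
  unfold risk2 at hr0 hr1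
  rw [norm2_indicator d S0 hS0 (1 / V) (by positivity) (by rw [hv0]; congr 1; field_simp),
    jointLaw_indicator d n S0 hS0 _ (by positivity)] at hr0
  have hr1' : ∀ σ, ∫⁻ x, ENNReal.ofReal ((N x - √(2 / V)) ^ 2)
      ∂((ENNReal.ofReal (2 / V) ^ n) • (volume : Measure (Fin n → Fin d → ℝ)).restrict
        (Set.univ.pi fun _ => S σ)) ≤ ENNReal.ofReal ρ1 := by
    intro σ
    have := hr1 σ
    rwa [norm2_indicator d (S σ) (hS σ) (2 / V) (by positivity) (by rw [hvσ]; congr 1; field_simp),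
      jointLaw_indicator d n (S σ) (hS σ) _ (by positivity)] at this
  set B0 : Set (Fin n → Fin d → ℝ) := Set.univ.pi fun _ => S0 with hB0
  set B : (Fin M → Bool) → Set (Fin n → Fin d → ℝ) := fun σ => Set.univ.pi fun _ => S σ with hB
  have mB0 : MeasurableSet B0 := MeasurableSet.univ_pi fun _ => hS0
  have mB : ∀ σ, MeasurableSet (B σ) := fun σ => MeasurableSet.univ_pi fun _ => hS σ
  have hBsub : ∀ σ, B σ ⊆ B0 := fun σ => Set.pi_mono fun _ _ => hsub σ
  have vB : ∀ σ, volume (B σ) = ENNReal.ofReal (V / 2) ^ n := by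
    intro σ; simp [hB, volume_pi_pi, hvσ]
  have vBB : ∀ σ τ, volume (B σ ∩ B τ) = ENNReal.ofReal ((V / 4) ^ n * (2 * (agree σ τ : ℝ) / M) ^ n) := by
    intro σ τ
    simp only [hB, ← Set.pi_inter_distrib, volume_pi_pi, hv, Finset.prod_const, Finset.card_univ,
      Fintype.card_fin]
    rw [← ENNReal.ofReal_pow (by positivity), ← mul_pow]
    congr 2
    field_simp
    ring
  set e : ℝ := 1 / (25 * V) with he
  have hepos : 0 < e := by positivity
  set A : Set (Fin n → Fin d → ℝ) :=
    {x | ENNReal.ofReal e ≤ ENNReal.ofReal ((N x - √(1 / V)) ^ 2)} with hA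
  have mF : ∀ m : ℝ, Measurable fun x => ENNReal.ofReal ((N x - m) ^ 2) := fun m =>
    ((hN.sub_const m).pow_const 2).ennreal_ofReal
  have mA : MeasurableSet A := measurableSet_le measurable_const (mF _)
  -- bound for P0(A)
  have hP0 : ENNReal.ofReal (1 / V) ^ n * volume (A ∩ B0) ≤ ENNReal.ofReal (25 * V * ρ0) := by
    have := (mul_meas_ge_le_lintegral (μ := (ENNReal.ofReal (1 / V) ^ n) •
      (volume : Measure (Fin n → Fin d → ℝ)).restrict B0) (mF (√(1 / V))) (ENNReal.ofReal e)).trans hr0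
    rw [Measure.smul_apply, Measure.restrict_apply mA, smul_eq_mul] at this
    calc _ = ENNReal.ofReal (25 * V) * (ENNReal.ofReal e * (ENNReal.ofReal (1 / V) ^ n * volume (A ∩ B0))) := by
          rw [← mul_assoc (ENNReal.ofReal (25 * V)), ← ENNReal.ofReal_mul (by positivity),
            show 25 * V * e = 1 by rw [he]; field_simp]; simp
      _ ≤ ENNReal.ofReal (25 * V) * ENNReal.ofReal ρ0 := by gcongr
      _ = _ := by rw [← ENNReal.ofReal_mul (by positivity)]
  have hB0A : volume (A ∩ B0) ≤ ENNReal.ofReal (V ^ n * (25 * V * ρ0)) := by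
    calc volume (A ∩ B0) = ENNReal.ofReal (V ^ n) * (ENNReal.ofReal (1 / V) ^ n * volume (A ∩ B0)) := by
          rw [← ENNReal.ofReal_pow (by positivity), ← mul_assoc, ← ENNReal.ofReal_mul (by positivity),
            ← mul_pow, show V * (1 / V) = 1 by field_simp]; simp
      _ ≤ ENNReal.ofReal (V ^ n) * ENNReal.ofReal (25 * V * ρ0) := by gcongr
      _ = _ := by rw [← ENNReal.ofReal_mul (by positivity)]
  -- second moment
  have hP1 : ∑ σ, ENNReal.ofReal (2 / V) ^ n * volume (A ∩ B σ) ≤ ENNReal.ofReal (2 ^ M / 2) := by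
    set s : ℝ := 2 ^ n / (4 * 2 ^ M * K) with hs
    have hspos : 0 < s := by positivity
    have hsm := sm_measure (volume : Measure (Fin n → Fin d → ℝ)) B mB (A ∩ B0) (mA.inter mB0) s hspos
    have hAB : ∀ σ, A ∩ B0 ∩ B σ = A ∩ B σ := fun σ => by
      rw [Set.inter_assoc, Set.inter_eq_right.mpr (hBsub σ)]
    simp_rw [hAB, vBB] at hsm
    have hcount : ∑ σ : Fin M → Bool, ∑ τ : Fin M → Bool,
        ENNReal.ofReal ((V / 4) ^ n * (2 * (agree σ τ : ℝ) / M) ^ n)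
          ≤ ENNReal.ofReal ((V / 4) ^ n * (4 ^ M * K)) := by
      have : ∀ σ : Fin M → Bool, ∑ τ : Fin M → Bool,
        ENNReal.ofReal ((V / 4) ^ n * (2 * (agree σ τ : ℝ) / M) ^ n) =
          ENNReal.ofReal ((V / 4) ^ n * ∑ τ : Fin M → Bool, (2 * (agree σ τ : ℝ) / M) ^ n) := by
        intro σ
        rw [← ENNReal.ofReal_sum_of_nonneg (fun _ _ => by positivity), Finset.mul_sum]
      simp_rw [this]
      rw [← ENNReal.ofReal_sum_of_nonneg (fun _ _ => by positivity), ← Finset.mul_sum]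
      apply ENNReal.ofReal_le_ofReal
      apply mul_le_mul_of_nonneg_left (count_bound n M hM) (by positivity)
    rw [← Finset.mul_sum]
    calc _ ≤ ENNReal.ofReal (2 / V) ^ n * (ENNReal.ofReal s * ENNReal.ofReal ((V / 4) ^ n * (4 ^ M * K))
          + ENNReal.ofReal (1 / (4 * s)) * ENNReal.ofReal (V ^ n * (25 * V * ρ0))) := by
          gcongr
          exact hsm.trans (by gcongr)
      _ = ENNReal.ofReal ((2 / V) ^ n * (s * ((V / 4) ^ n * (4 ^ M * K))
            + 1 / (4 * s) * (V ^ n * (25 * V * ρ0)))) := by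
          rw [← ENNReal.ofReal_mul (by positivity), ← ENNReal.ofReal_mul (by positivity),
            ← ENNReal.ofReal_add (by positivity) (by positivity), ← ENNReal.ofReal_pow (by positivity),
            ← ENNReal.ofReal_mul (by positivity)]
      _ ≤ _ := by
          apply ENNReal.ofReal_le_ofReal
          have e1 : (2 / V) ^ n * (s * ((V / 4) ^ n * (4 ^ M * K))) = 2 ^ M / 4 := by
            rw [hs, div_pow, div_pow, show (4:ℝ) ^ M = 2 ^ M * 2 ^ M by rw [← mul_pow]; norm_num,
              show (4:ℝ) ^ n = 2 ^ n * 2 ^ n by rw [← mul_pow]; norm_num]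
            field_simp
          have e2 : (2 / V) ^ n * (1 / (4 * s) * (V ^ n * (25 * V * ρ0))) = 2 ^ M / 4 * (100 * K * V * ρ0) := by
            rw [hs, div_pow]
            field_simp
            ring
          rw [mul_add, e1, e2]
          have : (2:ℝ) ^ M / 4 * (100 * K * V * ρ0) ≤ 2 ^ M / 4 * 1 :=
            mul_le_mul_of_nonneg_left hK (by positivity)
          linarith
  -- complement
  have hP2 : ∀ σ, ENNReal.ofReal (2 / V) ^ n * volume (Aᶜ ∩ B σ) ≤ ENNReal.ofReal (25 * V * ρ1) := by
    intro σ
    have := (mul_meas_ge_le_lintegral (μ := (ENNReal.ofReal (2 / V) ^ n) •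
      (volume : Measure (Fin n → Fin d → ℝ)).restrict (B σ)) (mF (√(2 / V))) (ENNReal.ofReal e)).trans (hr1' σ)
    rw [Measure.smul_apply, Measure.restrict_apply (measurableSet_le measurable_const (mF _)),
      smul_eq_mul] at this
    have hsubset : Aᶜ ⊆ {x | ENNReal.ofReal e ≤ ENNReal.ofReal ((N x - √(2 / V)) ^ 2)} := by
      intro x hx
      simp only [hA, Set.mem_compl_iff, Set.mem_ofPred_eq, not_le] at hx ⊢
      apply ENNReal.ofReal_le_ofReal
      have hx' := (ENNReal.ofReal_lt_ofReal_iff_of_nonneg (sq_nonneg _)).1 hx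
      set w := √(1 / V) with hw
      have hwpos : 0 < w := by rw [hw]; positivity
      have hw2 : w ^ 2 = 1 / V := Real.sq_sqrt (by positivity)
      have h2w : √(2 / V) = √2 * w := by
        rw [hw, ← Real.sqrt_mul (by norm_num)]; congr 1; ring
      have hew : e = (w / 5) ^ 2 := by rw [div_pow, hw2, he]; field_simp; norm_num
      rw [hew] at hx'
      rw [h2w, hew]
      have habs := abs_lt_of_sq_lt_sq hx' (by positivity)
      have h7 : (7:ℝ)/5 ≤ √2 := Real.le_sqrt_of_sq_le (by norm_num)
      have h7w : 7 / 5 * w ≤ √2 * w := mul_le_mul_of_nonneg_right h7 hwpos.le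
      rw [abs_lt] at habs
      have : w / 5 ≤ √2 * w - N x := by linarith [habs.2]
      nlinarith
    calc _ = ENNReal.ofReal (25 * V) * (ENNReal.ofReal e * (ENNReal.ofReal (2 / V) ^ n * volume (Aᶜ ∩ B σ))) := by
          rw [← mul_assoc (ENNReal.ofReal (25 * V)), ← ENNReal.ofReal_mul (by positivity),
            show 25 * V * e = 1 by rw [he]; field_simp]; simp
      _ ≤ ENNReal.ofReal (25 * V) * ENNReal.ofReal ρ1 := by
          gcongr
          refine le_trans ?_ this
          gcongr
      _ = _ := by rw [← ENNReal.ofReal_mul (by positivity)]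
  have htot : ∀ σ, (1 : ℝ≥0∞) ≤ ENNReal.ofReal (2 / V) ^ n * volume (A ∩ B σ)
      + ENNReal.ofReal (25 * V * ρ1) := by
    intro σ
    calc (1 : ℝ≥0∞) = ENNReal.ofReal (2 / V) ^ n * volume (B σ) := by
          rw [vB, ← mul_pow, ← ENNReal.ofReal_mul (by positivity), show 2 / V * (V / 2) = 1 by field_simp]
          simp
      _ = ENNReal.ofReal (2 / V) ^ n * volume (A ∩ B σ) + ENNReal.ofReal (2 / V) ^ n * volume (Aᶜ ∩ B σ) := by
          rw [← mul_add, Set.inter_comm A, Set.inter_comm Aᶜ, ← Set.sdiff_eq, measure_inter_add_sdiff _ mA]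
      _ ≤ _ := by gcongr; exact hP2 σ
  have hsum := Finset.sum_le_sum fun σ (_ : σ ∈ (Finset.univ : Finset (Fin M → Bool))) => htot σ
  rw [Finset.sum_add_distrib] at hsum
  have hsum2 := hsum.trans (add_le_add_left hP1 _)
  simp only [Finset.sum_const, Finset.card_univ, Fintype.card_pi, Fintype.card_bool,
          Finset.prod_const, Fintype.card_fin, nsmul_eq_mul, mul_one] at hsum2
  have hc2 : (((2 ^ M : ℕ) : ℝ≥0∞)) = ENNReal.ofReal (2 ^ M) := by
    rw [ENNReal.ofReal_pow (by norm_num)]; simp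
  rw [hc2, ← ENNReal.ofReal_mul (by positivity), ← ENNReal.ofReal_add (by positivity) (by positivity),
    ENNReal.ofReal_le_ofReal_iff (by positivity)] at hsum2
  have h2M : (0:ℝ) < 2 ^ M := by positivity
  by_contra hcon
  push Not at hcon
  have : (2:ℝ) ^ M * (50 * V * ρ1) < 2 ^ M * 1 := mul_lt_mul_of_pos_left hcon h2M
  linarith

/-- The shift of a set of reals. -/
def shiftSet (u : ℝ) (T : Set ℝ) : Set ℝ := {t | t + u ∈ T}

/-- Symmetric difference of a set and its shift. -/
def sd (u : ℝ) (T : Set ℝ) : Set ℝ := (T \ shiftSet u T) ∪ (shiftSet u T \ T)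

lemma measurableSet_shiftSet (u : ℝ) {T : Set ℝ} (hT : MeasurableSet T) :
    MeasurableSet (shiftSet u T) := (measurable_add_const u) hT

lemma measurableSet_sd (u : ℝ) {T : Set ℝ} (hT : MeasurableSet T) : MeasurableSet (sd u T) :=
  (hT.diff (measurableSet_shiftSet u hT)).union ((measurableSet_shiftSet u hT).diff hT)

lemma volume_sd_le (u : ℝ) (T : Set ℝ) : volume (sd u T) ≤ 2 * volume T := by
  have : volume (shiftSet u T) = volume T := measure_preimage_add_right volume u T
  calc volume (sd u T) ≤ volume (T \ shiftSet u T) + volume (shiftSet u T \ T) := measure_union_le _ _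
    _ ≤ volume T + volume T := by
      refine add_le_add (measure_mono Set.sdiff_subset) ?_
      exact (measure_mono Set.sdiff_subset).trans this.le
    _ = _ := by ring

lemma volume_sd_Ico (u a b : ℝ) : volume (sd u (Set.Ico a b)) ≤ ENNReal.ofReal (4 * |u|) := by
  have : sd u (Set.Ico a b) ⊆ Set.Icc (a - |u|) (a + |u|) ∪ Set.Icc (b - |u|) (b + |u|) := by
    intro t ht
    simp only [sd, shiftSet, Set.mem_union, Set.mem_sdiff, Set.mem_Ico, Set.mem_ofPred_eq, Set.mem_Icc,
      not_and, not_lt] at ht ⊢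
    have h1 := neg_abs_le u
    have h2 := le_abs_self u
    rcases ht with ⟨⟨h3, h4⟩, h5⟩ | ⟨⟨h3, h4⟩, h5⟩
    · by_cases h : a ≤ t + u
      · right; have := h5 h; constructor <;> linarith
      · left; push Not at h; constructor <;> linarith
    · by_cases h : a ≤ t
      · right; have := h5 h; constructor <;> linarith
      · left; push Not at h; constructor <;> linarith
  calc _ ≤ _ := measure_mono this
    _ ≤ _ := measure_union_le _ _
    _ = ENNReal.ofReal (4 * |u|) := by
      rw [Real.volume_Icc, Real.volume_Icc, ← ENNReal.ofReal_add (by ring_nf; positivity) (by ring_nf; positivity)]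
      congr 1; ring

lemma volume_sd_iUnion (u : ℝ) (M : ℕ) (a b : Fin M → ℝ) :
    volume (sd u (⋃ i, Set.Ico (a i) (b i))) ≤ ENNReal.ofReal (4 * M * |u|) := by
  have : sd u (⋃ i, Set.Ico (a i) (b i)) ⊆ ⋃ i, sd u (Set.Ico (a i) (b i)) := by
    intro t ht
    rcases ht with ⟨h1, h2⟩ | ⟨h1, h2⟩
    · obtain ⟨i, hi⟩ := Set.mem_iUnion.1 h1
      refine Set.mem_iUnion.2 ⟨i, Or.inl ⟨hi, fun h => h2 (Set.mem_iUnion.2 ⟨i, h⟩)⟩⟩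
    · obtain ⟨i, hi⟩ := Set.mem_iUnion.1 h1
      refine Set.mem_iUnion.2 ⟨i, Or.inr ⟨hi, fun h => h2 (Set.mem_iUnion.2 ⟨i, h⟩)⟩⟩
  calc _ ≤ _ := measure_mono this
    _ ≤ ∑ i, volume (sd u (Set.Ico (a i) (b i))) := measure_iUnion_fintype_le _ _
    _ ≤ ∑ i : Fin M, ENNReal.ofReal (4 * |u|) := Finset.sum_le_sum fun i _ => volume_sd_Ico _ _ _
    _ = _ := by
      rw [Finset.sum_const, Finset.card_univ, Fintype.card_fin, nsmul_eq_mul,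
        ← ENNReal.ofReal_natCast, ← ENNReal.ofReal_mul (by positivity)]
      congr 1; ring

/-- sides of the slab -/
def sides (m : ℕ) (T : Set ℝ) : Fin (m + 1) → Set ℝ := Fin.cons T (fun _ => Set.Ico 0 1)

/-- `T × [0,1)^m`. -/
def slab (m : ℕ) (T : Set ℝ) : Set (Fin (m + 1) → ℝ) := Set.univ.pi (sides m T)

lemma measurableSet_sides (m : ℕ) {T : Set ℝ} (hT : MeasurableSet T) (j : Fin (m + 1)) :
    MeasurableSet (sides m T j) := by
  refine Fin.cases ?_ (fun i => ?_) j
  · simpa [sides] using hT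
  · simp [sides, measurableSet_Ico]

lemma measurableSet_slab (m : ℕ) {T : Set ℝ} (hT : MeasurableSet T) : MeasurableSet (slab m T) :=
  MeasurableSet.univ_pi (measurableSet_sides m hT)

lemma volume_slab (m : ℕ) (T : Set ℝ) : volume (slab m T) = volume T := by
  rw [slab, volume_pi_pi, Fin.prod_univ_succ]
  simp [sides]

lemma slab_inter (m : ℕ) (T T' : Set ℝ) : slab m T ∩ slab m T' = slab m (T ∩ T') := by
  rw [slab, slab, slab, ← Set.pi_inter_distrib]
  congr 1
  ext j
  refine Fin.cases ?_ (fun i => ?_) j <;> simp [sides]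

lemma slab_mono (m : ℕ) {T T' : Set ℝ} (h : T ⊆ T') : slab m T ⊆ slab m T' := by
  apply Set.pi_mono
  intro j _
  refine Fin.cases ?_ (fun i => ?_) j <;> simp [sides, h]

/-- box containing the symmetric difference of a box and its shift -/
lemma diffOp_indicator_le (m : ℕ) (E : Fin (m + 1) → Set ℝ) (c : ℝ) (hc : 0 ≤ c) (u : ℝ)
    (j : Fin (m + 1)) (x : Fin (m + 1) → ℝ) :
    ‖diffOp (m + 1) u j ((Set.univ.pi E).indicator fun _ => c) x‖ ≤
      (Set.univ.pi (Function.update E j (sd u (E j)))).indicator (fun _ => c) x := by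
  classical
  set y : Fin (m + 1) → ℝ := fun i => x i + if i = j then u else 0 with hy
  have hyj : y j = x j + u := by simp [hy]
  have hyi : ∀ i, i ≠ j → y i = x i := by intro i hi; simp [hy, hi]
  have hnn : 0 ≤ (Set.univ.pi (Function.update E j (sd u (E j)))).indicator (fun _ => c) x :=
    Set.indicator_nonneg (fun _ _ => hc) x
  have hmem : ∀ (h : ∀ i, i ≠ j → x i ∈ E i) (h' : x j ∈ sd u (E j)),
      x ∈ Set.univ.pi (Function.update E j (sd u (E j))) := by
    intro h h' i _
    by_cases hi : i = j
    · subst hi; simpa using h'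
    · simpa [hi] using h i hi
  have : diffOp (m + 1) u j ((Set.univ.pi E).indicator fun _ => c) x =
    (Set.univ.pi E).indicator (fun _ => c) y - (Set.univ.pi E).indicator (fun _ => c) x := rfl
  rw [this]
  by_cases h1 : y ∈ Set.univ.pi E <;> by_cases h2 : x ∈ Set.univ.pi E
  · rw [Set.indicator_of_mem h1, Set.indicator_of_mem h2]; simpa using hnn
  · rw [Set.indicator_of_mem h1, Set.indicator_of_notMem h2]
    have h3 : ∀ i, i ≠ j → x i ∈ E i := fun i hi => hyi i hi ▸ h1 i trivial
    have h4 : x j ∉ E j := by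
      intro h; apply h2; intro i _
      by_cases hi : i = j
      · subst hi; exact h
      · exact h3 i hi
    rw [Set.indicator_of_mem (hmem h3 (Or.inr ⟨by
      change x j + u ∈ E j
      rw [← hyj]; exact h1 j trivial, h4⟩))]
    simp [abs_of_nonneg hc]
  · rw [Set.indicator_of_notMem h1, Set.indicator_of_mem h2]
    have h3 : ∀ i, i ≠ j → x i ∈ E i := fun i hi => h2 i trivial
    have h4 : x j + u ∉ E j := by
      intro h; apply h1; intro i _
      by_cases hi : i = j
      · subst hi; rw [hyj]; exact h
      · rw [hyi i hi]; exact h3 i hi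
    rw [Set.indicator_of_mem (hmem h3 (Or.inl ⟨h2 j trivial, h4⟩))]
    simp [abs_of_nonneg hc]
  · rw [Set.indicator_of_notMem h1, Set.indicator_of_notMem h2]; simpa using hnn

lemma eLpNorm_diffOp_le (m : ℕ) (T : Set ℝ) (hT : MeasurableSet T) (c : ℝ) (hc : 0 ≤ c) (u : ℝ)
    (j : Fin (m + 1)) (p : ℝ≥0∞) (hp : p ≠ 0) (hp' : p ≠ ⊤) :
    eLpNorm (diffOp (m + 1) u j ((slab m T).indicator fun _ => c)) p volume ≤
      ENNReal.ofReal c * (volume (Set.univ.pi (Function.update (sides m T) j (sd u (sides m T j)))))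
        ^ (1 / p.toReal) := by
  refine (eLpNorm_mono_real (diffOp_indicator_le m (sides m T) c hc u j)).trans ?_
  rw [eLpNorm_indicator_const _ hp hp', Real.enorm_of_nonneg hc]
  apply MeasurableSet.univ_pi
  intro i
  by_cases hi : i = j
  · subst hi; simpa using measurableSet_sd u (measurableSet_sides m hT i)
  · simpa [hi] using measurableSet_sides m hT i

lemma volume_update_zero (m : ℕ) (T : Set ℝ) (u : ℝ) :
    volume (Set.univ.pi (Function.update (sides m T) 0 (sd u (sides m T 0)))) = volume (sd u T) := by
  rw [volume_pi_pi, Fin.prod_univ_succ]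
  simp [sides]

lemma volume_update_succ (m : ℕ) (T : Set ℝ) (u : ℝ) (j : Fin m) :
    volume (Set.univ.pi (Function.update (sides m T) j.succ (sd u (sides m T j.succ))))
      = volume T * volume (sd u (Set.Ico (0:ℝ) 1)) := by
  rw [volume_pi_pi, Fin.prod_univ_succ]
  have h0 : Function.update (sides m T) j.succ (sd u (sides m T j.succ)) 0 = T := by
    rw [Function.update_of_ne (Fin.succ_ne_zero j).symm]; simp [sides]
  rw [h0]
  congr 1
  rw [Finset.prod_eq_single j]
  · simp [sides]
  · intro i _ hi
    rw [Function.update_of_ne (by simpa using hi)]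
    simp [sides]
  · simp

/-- integrability exponents -/
def rr (m : ℕ) : Fin (m + 1) → ℝ≥0∞ := Fin.cons 4 (fun _ => 1)

/-- smoothness exponents -/
noncomputable def bb (m : ℕ) (b : ℝ) : Fin (m + 1) → ℝ := Fin.cons b (fun _ => 1 / 2)

lemma mem_class (m : ℕ) (c : ℝ) (hc : 0 < c) (hc2 : c ≤ 2) (T : Set ℝ) (hT : MeasurableSet T)
    (hvT : volume T = ENNReal.ofReal (1 / c)) (b : ℝ) (hb : 0 < b) (hb1 : b < 1)
    (W : ℝ → ℝ) (hW : ∀ u, volume (sd u T) ≤ ENNReal.ofReal (W u)) (hW0 : ∀ u, 0 ≤ W u)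
    (hWb : ∀ u, c ^ 4 * W u ≤ 256 * |u| ^ (4 * b)) :
    (slab m T).indicator (fun _ => c) ∈ FClass (m + 1) (bb m b) (rr m) 2 (fun _ => 4) 4 := by
  have hS := measurableSet_slab m hT
  have hvS : volume (slab m T) = ENNReal.ofReal (1 / c) := by rw [volume_slab, hvT]
  have hic : 0 < 1 / c := by positivity
  refine ⟨⟨measurable_const.indicator hS, fun x => Set.indicator_nonneg (fun _ _ => hc.le) x, ?_⟩,
    ⟨fun j => ?_, fun j => ⟨1, ?_, fun u => ?_⟩⟩, ?_⟩
  · rw [integral_indicator_const _ hS, Measure.real, hvS, ENNReal.toReal_ofReal hic.le]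
    simp [hc.ne']
  · rw [eLpNorm_indicator_const hS, hvS, Real.enorm_of_nonneg hc.le]
    · refine Fin.cases ?_ (fun i => ?_) j
      · simp only [rr, Fin.cons_zero, ENNReal.toReal_ofNat]
        rw [ENNReal.ofReal_rpow_of_pos hic, ← ENNReal.ofReal_mul hc.le]
        apply ENNReal.ofReal_le_ofReal
        have h1 : (c * (1 / c) ^ ((1:ℝ) / 4)) ^ 4 = c ^ 3 := by
          rw [mul_pow, ← Real.rpow_natCast ((1 / c) ^ ((1:ℝ) / 4)), ← Real.rpow_mul hic.le]
          norm_num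
          field_simp
        apply le_of_pow_le_pow_left₀ (n := 4) (by norm_num) (by norm_num)
        rw [h1]
        calc c ^ 3 ≤ 2 ^ 3 := pow_le_pow_left₀ hc.le hc2 3
          _ ≤ _ := by norm_num
      · simp only [rr, Fin.cons_succ, ENNReal.toReal_one]
        rw [ENNReal.ofReal_rpow_of_pos hic, ← ENNReal.ofReal_mul hc.le]
        apply ENNReal.ofReal_le_ofReal
        rw [div_one, Real.rpow_one, mul_one_div_cancel hc.ne']
        norm_num
    · refine Fin.cases ?_ (fun i => ?_) j <;> simp [rr]
    · refine Fin.cases ?_ (fun i => ?_) j <;> simp [rr]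
  · refine Fin.cases ?_ (fun i => ?_) j
    · simpa [bb] using hb1
    · simp [bb]; norm_num
  · simp only [Function.iterate_one]
    refine (eLpNorm_diffOp_le m T hT c hc.le u j _ ?_ ?_).trans ?_
    · refine Fin.cases ?_ (fun i => ?_) j <;> simp [rr]
    · refine Fin.cases ?_ (fun i => ?_) j <;> simp [rr]
    · refine Fin.cases ?_ (fun i => ?_) j
      · rw [volume_update_zero]
        simp only [rr, bb, Fin.cons_zero, ENNReal.toReal_ofNat]
        calc _ ≤ ENNReal.ofReal c * ENNReal.ofReal (W u) ^ ((1:ℝ)/4) := by gcongr; exact hW u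
          _ = ENNReal.ofReal (c * W u ^ ((1:ℝ)/4)) := by
            rw [ENNReal.ofReal_rpow_of_nonneg (hW0 u) (by norm_num), ENNReal.ofReal_mul hc.le]
          _ ≤ _ := by
            apply ENNReal.ofReal_le_ofReal
            apply le_of_pow_le_pow_left₀ (n := 4) (by norm_num) (by positivity)
            rw [mul_pow, mul_pow, ← Real.rpow_natCast (W u ^ ((1:ℝ) / 4)), ← Real.rpow_mul (hW0 u),
              ← Real.rpow_natCast (|u| ^ b), ← Real.rpow_mul (abs_nonneg u)]
            have := hWb u
            norm_num
            rwa [mul_comm b]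
      · rw [volume_update_succ, hvT]
        simp only [rr, bb, Fin.cons_succ, ENNReal.toReal_one, div_one, ENNReal.rpow_one]
        rw [← mul_assoc, ← ENNReal.ofReal_mul hc.le, mul_one_div_cancel hc.ne', ENNReal.ofReal_one, one_mul]
        by_cases hu : |u| ≤ 1
        · refine (volume_sd_Ico u 0 1).trans (ENNReal.ofReal_le_ofReal ?_)
          have : |u| ≤ |u| ^ ((1:ℝ) / 2) := by
            conv_lhs => rw [← Real.rpow_one |u|]
            exact Real.rpow_le_rpow_of_exponent_ge' (abs_nonneg u) hu (by norm_num) (by norm_num)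
          linarith
        · push Not at hu
          refine (volume_sd_le u _).trans ?_
          have : 1 ≤ |u| ^ ((1:ℝ) / 2) := Real.one_le_rpow hu.le (by norm_num)
          calc _ = ENNReal.ofReal 2 := by simp
            _ ≤ _ := ENNReal.ofReal_le_ofReal (by linarith)
  · rw [eLpNorm_indicator_const hS (by norm_num) (by norm_num), hvS, Real.enorm_of_nonneg hc.le,
      ENNReal.toReal_ofNat, ENNReal.ofReal_rpow_of_pos hic, ← ENNReal.ofReal_mul hc.le]
    apply ENNReal.ofReal_le_ofReal
    apply le_of_pow_le_pow_left₀ (n := 2) (by norm_num) (by norm_num)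
    rw [mul_pow, ← Real.rpow_natCast ((1 / c) ^ ((1:ℝ) / 2)), ← Real.rpow_mul hic.le]
    norm_num
    field_simp
    linarith

/-- half-cell -/
def hc (w : ℝ) (k : ℕ) : Set ℝ := Set.Ico (w * k) (w * (k + 1))

lemma hc_disj (w : ℝ) (hw : 0 < w) (k l : ℕ) (t : ℝ) (hk : t ∈ hc w k) (hl : t ∈ hc w l) : k = l := by
  obtain ⟨a1, a2⟩ := hk
  obtain ⟨b1, b2⟩ := hl
  have h1 : (k : ℝ) < l + 1 := lt_of_mul_lt_mul_left (a1.trans_lt b2) hw.le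
  have h2 : (l : ℝ) < k + 1 := lt_of_mul_lt_mul_left (b1.trans_lt a2) hw.le
  have h1' : k < l + 1 := by exact_mod_cast h1
  have h2' : l < k + 1 := by exact_mod_cast h2
  omega

lemma volume_hc (w : ℝ) (k : ℕ) : volume (hc w k) = ENNReal.ofReal w := by
  rw [hc, Real.volume_Ico]; congr 1; ring

/-- index of the selected half cell -/
def hidx {M : ℕ} (σ : Fin M → Bool) (i : Fin M) : ℕ := 2 * i + (σ i).toNat

/-- the union of selected half cells -/
def TT {M : ℕ} (w : ℝ) (σ : Fin M → Bool) : Set ℝ := ⋃ i, hc w (hidx σ i)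

lemma hidx_inj {M : ℕ} {σ τ : Fin M → Bool} {i j : Fin M} (h : hidx σ i = hidx τ j) :
    i = j ∧ σ i = τ j := by
  unfold hidx at h
  have h1 : (σ i).toNat ≤ 1 := Bool.toNat_le _
  have h2 : (τ j).toNat ≤ 1 := Bool.toNat_le _
  refine ⟨Fin.ext (by omega), ?_⟩
  have : (σ i).toNat = (τ j).toNat := by omega
  revert this
  cases σ i <;> cases τ j <;> simp

lemma measurableSet_TT {M : ℕ} (w : ℝ) (σ : Fin M → Bool) : MeasurableSet (TT w σ) :=
  MeasurableSet.iUnion fun _ => measurableSet_Ico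

lemma TT_sub {M : ℕ} (w : ℝ) (hw : 0 < w) (σ : Fin M → Bool) :
    TT w σ ⊆ Set.Ico 0 (w * (2 * M)) := by
  intro t ht
  obtain ⟨i, h1, h2⟩ := Set.mem_iUnion.1 ht
  have h3 : hidx σ i + 1 ≤ 2 * M := by
    unfold hidx
    have h1 : (σ i).toNat ≤ 1 := Bool.toNat_le _
    have := i.2
    omega
  have h3' : (hidx σ i : ℝ) + 1 ≤ 2 * M := by exact_mod_cast h3
  refine ⟨le_trans (by positivity) h1, h2.trans_le (mul_le_mul_of_nonneg_left h3' hw.le)⟩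

lemma volume_TT_inter {M : ℕ} (w : ℝ) (hw : 0 < w) (σ τ : Fin M → Bool) :
    volume (TT w σ ∩ TT w τ) = ENNReal.ofReal (w * agree σ τ) := by
  have : TT w σ ∩ TT w τ = ⋃ i ∈ (Finset.univ.filter fun i => σ i = τ i), hc w (hidx σ i) := by
    ext t
    simp only [TT, Set.mem_inter_iff, Set.mem_iUnion, Finset.mem_filter, Finset.mem_univ, true_and,
      exists_prop]
    constructor
    · rintro ⟨⟨i, hi⟩, ⟨j, hj⟩⟩
      obtain ⟨h1, h2⟩ := hidx_inj (hc_disj w hw _ _ t hi hj)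
      subst h1
      exact ⟨i, h2, hi⟩
    · rintro ⟨i, h, hi⟩
      refine ⟨⟨i, hi⟩, ⟨i, ?_⟩⟩
      simpa [hidx, h] using hi
  rw [this, measure_biUnion_finset]
  · simp_rw [volume_hc]
    rw [Finset.sum_const, nsmul_eq_mul, ← ENNReal.ofReal_natCast, ← ENNReal.ofReal_mul (by positivity),
      mul_comm]
    rfl
  · intro i _ j _ hij
    refine Set.disjoint_left.2 fun t hi hj => hij ?_
    exact (hidx_inj (hc_disj w hw _ _ t hi hj)).1
  · intro i _
    exact measurableSet_Ico

lemma min_rpow (y a : ℝ) (hy : 0 ≤ y) (ha : 0 ≤ a) (ha1 : a ≤ 1) : min y 1 ≤ y ^ a := by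
  by_cases h : y ≤ 1
  · refine (min_le_left _ _).trans ?_
    conv_lhs => rw [← Real.rpow_one y]
    exact Real.rpow_le_rpow_of_exponent_ge' hy h ha ha1
  · exact (min_le_right _ _).trans (Real.one_le_rpow (not_le.1 h).le ha)

lemma f0_mem (m : ℕ) (V : ℝ) (hV : 1 ≤ V) (b : ℝ) (hb : 0 < b) (hb1 : 4 * b ≤ 1) :
    (slab m (Set.Ico 0 V)).indicator (fun _ => 1 / V) ∈ FClass (m + 1) (bb m b) (rr m) 2 (fun _ => 4) 4 := by
  have hV0 : 0 < V := by linarith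
  have hc1 : 1 / V ≤ 1 := by rw [div_le_one hV0]; exact hV
  refine mem_class m (1 / V) (by positivity) (by linarith) _ measurableSet_Ico
    (by rw [Real.volume_Ico]; congr 1; field_simp; ring) b hb (by linarith)
    (fun u => min (4 * |u|) (2 * V)) (fun u => ?_) (fun u => by positivity) (fun u => ?_)
  · rw [ENNReal.ofReal_min]
    refine le_min (volume_sd_Ico _ _ _) ((volume_sd_le _ _).trans_eq ?_)
    rw [Real.volume_Ico, sub_zero, ENNReal.ofReal_mul (by norm_num)]
    simp
  · have h1 := min_rpow |u| (4 * b) (abs_nonneg u) (by linarith) hb1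
    have h3 : (1 / V) ^ 4 ≤ 1 := pow_le_one₀ (by positivity) hc1
    have h4 : (1 / V) ^ 4 * V ≤ 1 := by
      have : (1 / V) ^ 4 * V = (1 / V) ^ 3 := by field_simp
      rw [this]; exact pow_le_one₀ (by positivity) hc1
    have h2 : (1 / V) ^ 4 * min (4 * |u|) (2 * V) ≤ 4 * min |u| 1 := by
      rcases le_total |u| 1 with h | h
      · rw [min_eq_left h]
        calc _ ≤ (1 / V) ^ 4 * (4 * |u|) := by gcongr; exact min_le_left _ _
          _ ≤ 1 * (4 * |u|) := by gcongr
          _ = _ := by ring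
      · rw [min_eq_right h]
        calc _ ≤ (1 / V) ^ 4 * (2 * V) := by gcongr; exact min_le_right _ _
          _ ≤ _ := by linarith
    have : 0 ≤ |u| ^ (4 * b) := by positivity
    linarith

lemma f1_mem (m M : ℕ) (hM : 0 < M) (b : ℝ) (hb : 0 < b) (hb1 : 4 * b ≤ 1) (V : ℝ)
    (hVdef : V = (M : ℝ) ^ (1 / (1 + 3 / (4 * b)))) (σ : Fin M → Bool) :
    (slab m (TT (V / (2 * M)) σ)).indicator (fun _ => 2 / V)
      ∈ FClass (m + 1) (bb m b) (rr m) 2 (fun _ => 4) 4 := by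
  have hM1 : (1:ℝ) ≤ M := by exact_mod_cast hM
  have hM' : (0:ℝ) < M := by linarith
  have hV : 1 ≤ V := by rw [hVdef]; exact Real.one_le_rpow hM1 (by positivity)
  have hV0 : 0 < V := by linarith
  have hvol : volume (TT (V / (2 * M)) σ) = ENNReal.ofReal (V / 2) := by
    have := volume_TT_inter (V / (2 * M)) (by positivity) σ σ
    rw [Set.inter_self] at this
    rw [this]; congr 1
    simp only [agree, Finset.filter_true, Finset.card_univ, Fintype.card_fin]
    field_simp
  refine mem_class m (2 / V) (by positivity) (by rw [div_le_iff₀ hV0]; linarith) _ (measurableSet_TT _ _)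
    (by rw [hvol]; congr 1; field_simp) b hb (by linarith)
    (fun u => min (4 * M * |u|) V) (fun u => ?_) (fun u => by positivity) (fun u => ?_)
  · rw [ENNReal.ofReal_min]
    refine le_min (volume_sd_iUnion _ _ _ _) ((volume_sd_le _ _).trans_eq ?_)
    rw [hvol, ← ENNReal.ofReal_ofNat 2, ← ENNReal.ofReal_mul (by norm_num)]
    congr 1; ring
  · set y := |u| * M / V with hy
    have hy0 : 0 ≤ y := by positivity
    have h1 := min_rpow y (4 * b) hy0 (by linarith) hb1
    have h2 : min (4 * M * |u|) V ≤ 4 * V * min y 1 := by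
      rw [mul_min_of_nonneg _ _ (by positivity)]
      apply min_le_min
      · rw [hy]; apply le_of_eq; field_simp
      · linarith
    have h3 : y ^ (4 * b) = |u| ^ (4 * b) * V ^ 3 := by
      rw [hy, mul_div_assoc, Real.mul_rpow (abs_nonneg u) (by positivity)]
      congr 1
      rw [Real.div_rpow hM'.le hV0.le, div_eq_iff (by positivity), ← Real.rpow_natCast V 3,
        ← Real.rpow_add hV0, hVdef, ← Real.rpow_mul hM'.le]
      congr 1
      push_cast
      field_simp
      ring
    calc (2 / V) ^ 4 * min (4 * M * |u|) V ≤ (2 / V) ^ 4 * (4 * V * (|u| ^ (4 * b) * V ^ 3)) := by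
          rw [← h3]
          gcongr
          exact h2.trans (by gcongr)
      _ = 64 * |u| ^ (4 * b) := by field_simp; norm_num; ring
      _ ≤ _ := by
        have : 0 ≤ |u| ^ (4 * b) := by positivity
        linarith

lemma rateExp_eq (m : ℕ) (b : ℝ) (hb : 0 < b) (h1 : 4 * b ≤ 1) (h2 : 4 * b * m ≤ 1) :
    rateExp (m + 1) (bb m b) (rr m) 2 = 1 / (1 + 3 / (4 * b)) := by
  have hO : invOmega (m + 1) (bb m b) (rr m) = 1 / (4 * b) + 2 * m := by
    rw [invOmega, Fin.sum_univ_succ]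
    simp [bb, rr]
    ring
  have hB : invBeta (m + 1) (bb m b) = 1 / b + 2 * m := by
    rw [invBeta, Fin.sum_univ_succ]
    simp [bb]
    ring
  have ht2 : tau (m + 1) (bb m b) (rr m) 2 = 1 + 1 / (4 * b) - m := by
    rw [tau, hO, hB]
    simp
    field_simp
    ring
  have ht1 : tau (m + 1) (bb m b) (rr m) 1 = 1 + 3 / (4 * b) := by
    rw [tau, hO, hB]
    simp
    field_simp
    ring
  have hm : (m : ℝ) ≤ 1 / (4 * b) := by
    rw [le_div_iff₀ (by positivity)]; linarith
  have h3 : 3 ≤ 3 / (4 * b) := by rw [le_div_iff₀ (by positivity)]; linarith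
  rw [rateExp, if_pos (by rw [ht2]; linarith), ht1, min_eq_right]
  apply one_div_le_one_div_of_le <;> linarith

lemma limsup_bound (d : ℕ) (F : Set ((Fin d → ℝ) → ℝ)) (z : ℝ)
    (N : (n : ℕ) → (Fin n → Fin d → ℝ) → ℝ)
    (h : atTop.limsup (fun n : ℕ => (n : ℝ≥0∞) ^ z * ⨆ f ∈ F, risk2 d n (N n) f ^ ((1 : ℝ) / 2)) < ⊤) :
    ∃ C : ℝ, 0 ≤ C ∧ ∀ᶠ n : ℕ in atTop, ∀ f ∈ F,
      risk2 d n (N n) f ≤ ENNReal.ofReal (C * ((n : ℝ) ^ 2) ^ (-z)) := by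
  obtain ⟨c, hc1, hc2⟩ := exists_between h
  refine ⟨c.toReal ^ 2, by positivity, ?_⟩
  filter_upwards [eventually_lt_of_limsup_lt hc1, eventually_ge_atTop 1] with n hn hn1 f hf
  have hn0 : (0:ℝ) < n := by exact_mod_cast hn1
  have h1 : (n : ℝ≥0∞) ^ z * risk2 d n (N n) f ^ ((1 : ℝ) / 2) ≤ ENNReal.ofReal c.toReal := by
    rw [ENNReal.ofReal_toReal hc2.ne]
    refine le_trans ?_ hn.le
    gcongr
    exact le_iSup₂ (f := fun f (_ : f ∈ F) => risk2 d n (N n) f ^ ((1 : ℝ) / 2)) f hf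
  rw [← ENNReal.ofReal_natCast, ENNReal.ofReal_rpow_of_pos hn0] at h1
  have hp : 0 < (n:ℝ) ^ (-z) := Real.rpow_pos_of_pos hn0 _
  have h2 : risk2 d n (N n) f ^ ((1 : ℝ) / 2) ≤ ENNReal.ofReal ((n : ℝ) ^ (-z) * c.toReal) := by
    calc _ = ENNReal.ofReal ((n : ℝ) ^ (-z)) *
          (ENNReal.ofReal ((n:ℝ) ^ z) * risk2 d n (N n) f ^ ((1 : ℝ) / 2)) := by
          rw [← mul_assoc, ← ENNReal.ofReal_mul hp.le, ← Real.rpow_add hn0]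
          simp
      _ ≤ ENNReal.ofReal ((n : ℝ) ^ (-z)) * ENNReal.ofReal c.toReal := by gcongr
      _ = _ := by rw [← ENNReal.ofReal_mul hp.le]
  calc risk2 d n (N n) f = (risk2 d n (N n) f ^ ((1 : ℝ) / 2)) ^ 2 := by
        rw [← ENNReal.rpow_natCast, ← ENNReal.rpow_mul]; norm_num
    _ ≤ (ENNReal.ofReal ((n : ℝ) ^ (-z) * c.toReal)) ^ 2 := by gcongr
    _ = _ := by
        rw [← ENNReal.ofReal_pow (by positivity)]
        congr 1
        rw [mul_pow, mul_comm, ← Real.rpow_natCast, ← Real.rpow_natCast ((n:ℝ) ^ (-z)),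
          ← Real.rpow_natCast (n:ℝ) 2, ← Real.rpow_mul hn0.le, ← Real.rpow_mul hn0.le, mul_comm (-z)]

/-- number of cells -/
noncomputable def MM (a : ℝ) (n : ℕ) : ℕ := ⌈(n : ℝ) ^ 2 / (a * Real.log n)⌉₊

lemma MM_tendsto (a : ℝ) (ha : 0 < a) :
    Tendsto (fun n : ℕ => (MM a n : ℝ) / (n : ℝ) ^ 2) atTop (nhds 0) := by
  have hlog : Tendsto (fun n : ℕ => Real.log n) atTop atTop :=
    Real.tendsto_log_atTop.comp tendsto_natCast_atTop_atTop
  have h1 : Tendsto (fun n : ℕ => 1 / (a * Real.log n) + 1 / (n : ℝ) ^ 2) atTop (nhds 0) := by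
    have e1 : Tendsto (fun n : ℕ => 1 / (a * Real.log n)) atTop (nhds 0) := by
      simp_rw [one_div]
      exact (hlog.const_mul_atTop ha).inv_tendsto_atTop
    have e2 : Tendsto (fun n : ℕ => 1 / (n : ℝ) ^ 2) atTop (nhds 0) := by
      simp_rw [one_div]
      exact ((tendsto_pow_atTop (two_ne_zero)).comp
        (tendsto_natCast_atTop_atTop (R := ℝ))).inv_tendsto_atTop
    simpa using e1.add e2
  refine tendsto_of_tendsto_of_tendsto_of_le_of_le' tendsto_const_nhds h1
    (Eventually.of_forall fun n => by positivity) ?_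
  filter_upwards [eventually_ge_atTop 2] with n hn
  have hn1 : (1:ℝ) < n := by exact_mod_cast hn
  have hl : 0 < Real.log n := Real.log_pos hn1
  have hlt := (Nat.ceil_lt_add_one (show 0 ≤ (n : ℝ) ^ 2 / (a * Real.log n) by positivity)).le
  calc (MM a n : ℝ) / (n : ℝ) ^ 2 ≤ ((n : ℝ) ^ 2 / (a * Real.log n) + 1) / (n : ℝ) ^ 2 := by
        gcongr; exact hlt
    _ = _ := by field_simp

lemma main_aux (m : ℕ) (N : (n : ℕ) → (Fin n → Fin (m + 1) → ℝ) → ℝ) (hN : ∀ n, Measurable (N n))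
    (h : ∀ (β : Fin (m + 1) → ℝ) (r : Fin (m + 1) → ℝ≥0∞) (q : ℝ≥0∞) (L : Fin (m + 1) → ℝ) (Q : ℝ),
        (∀ j, 0 < β j) → (∀ j, 1 ≤ r j) → 2 ≤ q → (∀ j, 0 < L j) → 0 < Q →
        atTop.limsup (fun n : ℕ =>
          (n : ℝ≥0∞) ^ rateExp (m + 1) β r q *
            ⨆ f ∈ FClass (m + 1) β r q L Q, risk2 (m + 1) n (N n) f ^ ((1 : ℝ) / 2)) < ⊤) : False := by
  have hbnd : ∀ b : ℝ, 0 < b → 4 * b ≤ 1 → 4 * b * m ≤ 1 →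
      ∃ C : ℝ, 0 ≤ C ∧ ∀ᶠ n : ℕ in atTop, ∀ f ∈ FClass (m + 1) (bb m b) (rr m) 2 (fun _ => 4) 4,
      risk2 (m + 1) n (N n) f ≤ ENNReal.ofReal (C * ((n : ℝ) ^ 2) ^ (-(1 / (1 + 3 / (4 * b))))) := by
    intro b hb h1 h2
    have := h (bb m b) (rr m) 2 (fun _ => 4) 4 (fun j => ?_) (fun j => ?_) le_rfl (fun _ => by norm_num)
      (by norm_num)
    · rw [rateExp_eq m b hb h1 h2] at this
      exact limsup_bound _ _ _ N this
    · refine Fin.cases ?_ (fun i => ?_) j <;> simp [bb, hb]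
    · refine Fin.cases ?_ (fun i => ?_) j <;> simp [rr]
  set b0 : ℝ := 1 / (4 * (m + 1)) with hb0
  set b1 : ℝ := 1 / (8 * (m + 1)) with hb1
  have hm0 : (0:ℝ) ≤ m := Nat.cast_nonneg m
  have b0pos : 0 < b0 := by positivity
  have b1pos : 0 < b1 := by positivity
  have e0 : 4 * b0 = 1 / (m + 1) := by rw [hb0]; field_simp
  have e1 : 4 * b1 = 1 / (2 * (m + 1)) := by rw [hb1]; field_simp; norm_num
  have e0' : 4 * b0 ≤ 1 := by rw [e0, div_le_one (by positivity)]; linarith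
  have e1' : 4 * b1 ≤ 1 := by rw [e1, div_le_one (by positivity)]; linarith
  have e0'' : 4 * b0 * m ≤ 1 := by
    rw [e0, one_div_mul_eq_div, div_le_one (by positivity)]; linarith
  have e1'' : 4 * b1 * m ≤ 1 := by
    rw [e1, one_div_mul_eq_div, div_le_one (by positivity)]; linarith
  obtain ⟨C0, hC0, hR0⟩ := hbnd b0 b0pos e0' e0''
  obtain ⟨C1, hC1, hR1⟩ := hbnd b1 b1pos e1' e1''
  set z0 : ℝ := 1 / (1 + 3 / (4 * b0)) with hz0
  set z1 : ℝ := 1 / (1 + 3 / (4 * b1)) with hz1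
  have z1pos : 0 < z1 := by positivity
  have hz : z1 < z0 := by
    rw [hz0, hz1, e0, e1]
    apply one_div_lt_one_div_of_lt (by positivity)
    have e3 : (3:ℝ) / (1 / (m + 1)) = 3 * (m + 1) := by field_simp
    have e4 : (3:ℝ) / (1 / (2 * (m + 1))) = 6 * (m + 1) := by field_simp; norm_num
    rw [e3, e4]; linarith
  set a : ℝ := 2 * (z0 - z1) with ha
  have hapos : 0 < a := by rw [ha]; linarith
  have hM := MM_tendsto a hapos
  -- condition 2
  have hcond2 : ∀ᶠ n : ℕ in atTop, 50 * C1 * ((MM a n : ℝ) / (n : ℝ) ^ 2) ^ z1 < 1 := by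
    have h1 : Tendsto (fun n : ℕ => 50 * C1 * ((MM a n : ℝ) / (n : ℝ) ^ 2) ^ z1) atTop (nhds 0) := by
      have := (hM.rpow_const (p := z1) (Or.inr z1pos.le)).const_mul (50 * C1)
      rwa [Real.zero_rpow z1pos.ne', mul_zero] at this
    exact h1.eventually_lt_const (by norm_num)
  have hcond1 : ∀ᶠ n : ℕ in atTop, 100 * C0 * (n : ℝ) ^ (-(z0 - z1)) < 1 := by
    have h1 : Tendsto (fun n : ℕ => 100 * C0 * (n : ℝ) ^ (-(z0 - z1))) atTop (nhds 0) := by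
      have := ((tendsto_rpow_neg_atTop (show 0 < z0 - z1 by linarith)).comp
        (tendsto_natCast_atTop_atTop (R := ℝ))).const_mul (100 * C0)
      rwa [mul_zero] at this
    exact h1.eventually_lt_const (by norm_num)
  have hM1 : ∀ᶠ n : ℕ in atTop, (MM a n : ℝ) / (n : ℝ) ^ 2 < 1 := hM.eventually_lt_const (by norm_num)
  obtain ⟨n, h0, h1, h2, h3, h4, hn⟩ := (hR0.and (hR1.and (hcond2.and (hcond1.and
    (hM1.and (eventually_ge_atTop 2)))))).exists
  have hn1 : (1:ℝ) < n := by exact_mod_cast hn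
  have hn0 : (0:ℝ) < n := by linarith
  have hl : 0 < Real.log n := Real.log_pos hn1
  set M := MM a n with hMdef
  have hMge : (n : ℝ) ^ 2 / (a * Real.log n) ≤ M := Nat.le_ceil _
  have hMpos' : (0:ℝ) < M := lt_of_lt_of_le (by positivity) hMge
  have hMpos : 0 < M := by exact_mod_cast hMpos'
  have hMle : (M : ℝ) ≤ (n : ℝ) ^ 2 := by
    rw [div_lt_one (by positivity)] at h4; exact h4.le
  set V : ℝ := (M : ℝ) ^ z1 with hV
  have hM1' : (1:ℝ) ≤ M := by exact_mod_cast hMpos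
  have hV1 : 1 ≤ V := Real.one_le_rpow hM1' z1pos.le
  have hV0 : 0 < V := by linarith
  have hw : 0 < V / (2 * M) := by positivity
  have hwV : V / (2 * M) * (2 * M) = V := by field_simp
  have key := core (m + 1) n M hMpos V hV0 (slab m (Set.Ico 0 V)) (fun σ => slab m (TT (V / (2 * M)) σ))
    (measurableSet_slab m measurableSet_Ico) (fun σ => measurableSet_slab m (measurableSet_TT _ _))
    (fun σ => slab_mono m (by have := TT_sub (V / (2 * M)) hw σ; rwa [hwV] at this))
    (by rw [volume_slab, Real.volume_Ico, sub_zero])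
    (fun σ τ => by
      rw [slab_inter, volume_slab, volume_TT_inter _ hw]; congr 1; field_simp)
    (N n) (hN n) (C0 * ((n : ℝ) ^ 2) ^ (-z0)) (C1 * ((n : ℝ) ^ 2) ^ (-z1)) (by positivity) (by positivity)
    (h0 _ (f0_mem m V hV1 b0 b0pos e0'))
    (fun σ => h1 _ (f1_mem m M hMpos b1 b1pos e1' V hV σ)) ?_
  · have : 50 * V * (C1 * ((n : ℝ) ^ 2) ^ (-z1)) = 50 * C1 * ((M : ℝ) / (n : ℝ) ^ 2) ^ z1 := by
      rw [Real.div_rpow hMpos'.le (by positivity), Real.rpow_neg (by positivity), hV]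
      ring
    rw [this] at key
    linarith
  · have hexp : Real.exp ((n : ℝ) ^ 2 / (2 * M)) ≤ (n : ℝ) ^ (z0 - z1) := by
      rw [Real.rpow_def_of_pos hn0]
      apply Real.exp_le_exp.2
      rw [div_le_iff₀ (by positivity)] at hMge ⊢
      have : Real.log n * (z0 - z1) * (2 * M) = M * (a * Real.log n) := by rw [ha]; ring
      rw [this]; exact hMge
    have hVle : V ≤ ((n : ℝ) ^ 2) ^ z1 := Real.rpow_le_rpow hMpos'.le hMle z1pos.le
    calc 100 * Real.exp ((n : ℝ) ^ 2 / (2 * M)) * V * (C0 * ((n : ℝ) ^ 2) ^ (-z0))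
        ≤ 100 * (n : ℝ) ^ (z0 - z1) * ((n : ℝ) ^ 2) ^ z1 * (C0 * ((n : ℝ) ^ 2) ^ (-z0)) := by gcongr
      _ = 100 * C0 * ((n : ℝ) ^ (z0 - z1) * ((n : ℝ) ^ 2) ^ z1 * ((n : ℝ) ^ 2) ^ (-z0)) := by ring
      _ = 100 * C0 * (n : ℝ) ^ (-(z0 - z1)) := by
          rw [← Real.rpow_natCast (n:ℝ) 2, ← Real.rpow_mul hn0.le, ← Real.rpow_mul hn0.le,
            ← Real.rpow_add hn0, ← Real.rpow_add hn0]
          congr 2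
          push_cast
          ring
      _ ≤ 1 := h3.le


/-- **Nonexistence of optimally-adaptive estimators of the `L₂`-norm of a density.**
There is no sequence of estimators which is simultaneously rate-optimal over all the
classes `𝓕_ϑ`, `ϑ = (β, r, q, L, Q)`. -/
theorem no_optimally_adaptive_estimator (d : ℕ) (hd : 1 ≤ d) :
    ¬ ∃ Nhat : (n : ℕ) → (Fin n → Fin d → ℝ) → ℝ,
      (∀ n, Measurable (Nhat n)) ∧
      ∀ (β : Fin d → ℝ) (r : Fin d → ℝ≥0∞) (q : ℝ≥0∞) (L : Fin d → ℝ) (Q : ℝ),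
        (∀ j, 0 < β j) → (∀ j, 1 ≤ r j) → 2 ≤ q → (∀ j, 0 < L j) → 0 < Q →
        atTop.limsup (fun n : ℕ =>
          (n : ℝ≥0∞) ^ rateExp d β r q *
            ⨆ f ∈ FClass d β r q L Q, risk2 d n (Nhat n) f ^ ((1 : ℝ) / 2)) < ⊤ := by
  rintro ⟨N, hN, h⟩
  obtain ⟨m, rfl⟩ : ∃ m, d = m + 1 := ⟨d - 1, by omega⟩
  exact main_aux m N hN h
end

section
/- There exists n₀ ∈ ℕ such that for every n ≥ n₀ the following holds. Let (𝒳, ν) be a measure space, M ≥ 1 an integer, and Λ₁,…,Λ_M : 𝒳 → [0,∞) measurable integrable functions with pairwise disjoint supports; let f₀ be a probability density on (𝒳, ν). Put λ_m = ∫ Λ_m dν, 𝔖 = max_m |λ_m|, 𝒟² = Σ_m λ_m². Let ℙ be a probability measure on an interval 𝕐 ⊆ [0,1] with mean e₁ = ∫ u ℙ(du); set Σ_M = e₁ Σ_m λ_m and assume Σ_M ≤ 1/4 and 256 𝔖² M n ≤ 1. For y ∈ 𝕐^M set ρ_y = Σ_m y_m λ_m, f_y = (1 − ρ_y) f₀ +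 Σ_m y_m Λ_m and f*_y = (1 − Σ_M) exp( −(ρ_y − Σ_M)/(1 − Σ_M) ) f₀ + Σ_m y_m Λ_m. Then for every y ∈ 𝕐^M with |ρ_y − Σ_M| ≤ 12 𝒟 and every x ∈ 𝒳: f*_y(x) ≥ f_y(x) ≥ e^{−1/n} f*_y(x). -/
open MeasureTheory Filter

noncomputable section

variable {𝒳 : Type*} [MeasurableSpace 𝒳]

/-- `λ_m = ∫ Λ_m dν`. -/
def lamInt (ν : Measure 𝒳) {M : ℕ} (Λ : Fin M → 𝒳 → ℝ) (m : Fin M) : ℝ :=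
  ∫ x, Λ m x ∂ν

/-- `ρ_y = Σ_m y_m λ_m`. -/
def rhoY (ν : Measure 𝒳) {M : ℕ} (Λ : Fin M → 𝒳 → ℝ) (y : Fin M → ℝ) : ℝ :=
  ∑ m, y m * lamInt ν Λ m

/-- `Σ_M = e₁ Σ_m λ_m` where `e₁ = ∫ u ℙ(du)`. -/
def SigM (ν : Measure 𝒳) (P : Measure ℝ) {M : ℕ} (Λ : Fin M → 𝒳 → ℝ) : ℝ :=
  (∫ u, u ∂P) * ∑ m, lamInt ν Λ m

/-- `f_y = (1 - ρ_y) f₀ + Σ_m y_m Λ_m`. -/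
def fy (ν : Measure 𝒳) {M : ℕ} (f₀ : 𝒳 → ℝ) (Λ : Fin M → 𝒳 → ℝ) (y : Fin M → ℝ) :
    𝒳 → ℝ :=
  fun x => (1 - rhoY ν Λ y) * f₀ x + ∑ m, y m * Λ m x

/-- `f*_y = (1 - Σ_M) exp(-(ρ_y - Σ_M)/(1 - Σ_M)) f₀ + Σ_m y_m Λ_m`. -/
def fyStar (ν : Measure 𝒳) (P : Measure ℝ) {M : ℕ} (f₀ : 𝒳 → ℝ) (Λ : Fin M → 𝒳 → ℝ)
    (y : Fin M → ℝ) : 𝒳 → ℝ :=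
  fun x => (1 - SigM ν P Λ) *
      Real.exp (-((rhoY ν Λ y - SigM ν P Λ) / (1 - SigM ν P Λ))) * f₀ x
    + ∑ m, y m * Λ m x

end

lemma aux_exp (t : ℝ) (h1 : -(1/2) ≤ t) (h2 : t ≤ 1/2) : Real.exp (-(t + t^2)) ≤ 1 - t := by
  have key : 1 ≤ (1 - t) * Real.exp (t + t^2) := by
    rcases le_total 0 t with h | h
    · have hu : 0 ≤ t + t^2 := by positivity
      have := Real.quadratic_le_exp_of_nonneg hu
      have h3 : (1 - t) * (1 + (t + t^2) + (t + t^2)^2/2) ≤ (1 - t) * Real.exp (t + t^2) :=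
        mul_le_mul_of_nonneg_left this (by linarith)
      have h5 : 1 ≤ (1 + t)^2 * (1 - t) := by nlinarith [mul_nonneg h h]
      have h4 : 0 ≤ t^2 * ((1 + t)^2 * (1 - t) - 2 * t) :=
        mul_nonneg (sq_nonneg t) (by linarith)
      nlinarith
    · have := Real.add_one_le_exp (t + t^2)
      have h3 : (1 - t) * (t + t^2 + 1) ≤ (1 - t) * Real.exp (t + t^2) :=
        mul_le_mul_of_nonneg_left this (by linarith)
      have h4 : 0 ≤ t^2 * (-t) := mul_nonneg (sq_nonneg t) (by linarith)
      nlinarith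
  rw [Real.exp_neg, inv_le_iff_one_le_mul₀ (Real.exp_pos _)]
  exact key

/-- **Lemma 1.** For all `n` large enough, whenever `Σ_M ≤ 1/4` and `256 𝔖² M n ≤ 1`,
for every `y ∈ 𝕐^M` with `|ρ_y - Σ_M| ≤ 12 𝒟` one has
`f*_y(x) ≥ f_y(x) ≥ e^{-1/n} f*_y(x)` for all `x`. -/
theorem fy_fyStar_sandwich :
    ∃ n₀ : ℕ, ∀ n : ℕ, n₀ ≤ n →
    ∀ (𝒳 : Type*) [MeasurableSpace 𝒳] (ν : Measure 𝒳) (M : ℕ), 1 ≤ M →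
    ∀ Λ : Fin M → 𝒳 → ℝ,
      (∀ m, Measurable (Λ m)) →
      (∀ m x, 0 ≤ Λ m x) →
      (∀ m, Integrable (Λ m) ν) →
      Pairwise (fun m m' : Fin M =>
        Disjoint (Function.support (Λ m)) (Function.support (Λ m'))) →
    ∀ f₀ : 𝒳 → ℝ, Measurable f₀ → (∀ x, 0 ≤ f₀ x) → (∫ x, f₀ x ∂ν) = 1 →
    ∀ 𝕐 : Set ℝ, 𝕐 ⊆ Set.Icc (0 : ℝ) 1 → 𝕐.OrdConnected →
    ∀ P : Measure ℝ, IsProbabilityMeasure P → P 𝕐 = 1 →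
    SigM ν P Λ ≤ 1 / 4 →
    256 * (⨆ m, |lamInt ν Λ m|) ^ 2 * M * n ≤ 1 →
    ∀ y : Fin M → ℝ, (∀ m, y m ∈ 𝕐) →
      |rhoY ν Λ y - SigM ν P Λ| ≤ 12 * Real.sqrt (∑ m, (lamInt ν Λ m) ^ 2) →
    ∀ x : 𝒳,
      fy ν f₀ Λ y x ≤ fyStar ν P f₀ Λ y x ∧
      Real.exp (-1 / n) * fyStar ν P f₀ Λ y x ≤ fy ν f₀ Λ y x := by
  refine ⟨4, ?_⟩
  intro n hn 𝒳 _ ν M hM Λ _ hΛ _ _ f₀ _ hf₀ _ 𝕐 h𝕐 _ P _ _ hS hn2 y hy hρ x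
  have hn4 : (4:ℝ) ≤ n := by exact_mod_cast hn
  have hn0 : (0:ℝ) < n := by linarith
  set S := SigM ν P Λ with hSdef
  set ρ := rhoY ν Λ y with hρdef
  set A := ⨆ m, |lamInt ν Λ m| with hA
  have hD : ∑ m, (lamInt ν Λ m) ^ 2 ≤ M * A ^ 2 := by
    calc ∑ m, (lamInt ν Λ m) ^ 2 ≤ ∑ _m : Fin M, A ^ 2 := by
          refine Finset.sum_le_sum fun m _ => ?_
          rw [← sq_abs]
          exact pow_le_pow_left₀ (abs_nonneg _)
            (le_ciSup (f := fun m => |lamInt ν Λ m|) (Set.finite_range _).bddAbove m) 2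
      _ = M * A ^ 2 := by simp
  have hD0 : 0 ≤ ∑ m, (lamInt ν Λ m) ^ 2 := Finset.sum_nonneg fun m _ => sq_nonneg _
  have hsq : (ρ - S) ^ 2 ≤ 144 * ∑ m, (lamInt ν Λ m) ^ 2 := by
    rw [← sq_abs]
    calc |ρ - S| ^ 2 ≤ (12 * Real.sqrt (∑ m, (lamInt ν Λ m) ^ 2)) ^ 2 :=
          pow_le_pow_left₀ (abs_nonneg _) hρ 2
      _ = _ := by rw [mul_pow, Real.sq_sqrt hD0]; norm_num
  have hS1 : 0 < 1 - S := by linarith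
  obtain ⟨t, ht⟩ : ∃ t, t = (ρ - S) / (1 - S) := ⟨_, rfl⟩
  have htS : ρ - S = t * (1 - S) := by rw [ht]; field_simp
  have ht2 : t ^ 2 ≤ 1 / n := by
    rw [le_div_iff₀ hn0]
    have h1 : t ^ 2 * (9/16) ≤ (ρ - S) ^ 2 := by
      rw [htS, mul_pow]
      exact mul_le_mul_of_nonneg_left (by nlinarith) (sq_nonneg t)
    have h2 : t ^ 2 ≤ 256 * (M * A ^ 2) := by linarith
    calc t ^ 2 * n ≤ 256 * (M * A ^ 2) * n := mul_le_mul_of_nonneg_right h2 hn0.le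
      _ = 256 * A ^ 2 * M * n := by ring
      _ ≤ 1 := hn2
  have ht4 : t ^ 2 ≤ (1/2) ^ 2 := by
    refine ht2.trans ?_
    rw [div_le_iff₀ hn0]; linarith
  have habs := abs_le.mp (abs_le_of_sq_le_sq ht4 (by norm_num))
  have hg : 0 ≤ ∑ m, y m * Λ m x :=
    Finset.sum_nonneg fun m _ => mul_nonneg (h𝕐 (hy m)).1 (hΛ m x)
  have hρt : 1 - ρ = (1 - S) * (1 - t) := by linarith
  have hup : 1 - t ≤ Real.exp (-t) := by linarith [Real.add_one_le_exp (-t)]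
  have hlow : Real.exp (-1 / n) * Real.exp (-t) ≤ 1 - t := by
    rw [← Real.exp_add]
    refine le_trans (Real.exp_le_exp.mpr ?_) (aux_exp t habs.1 habs.2)
    rw [neg_div]; linarith
  have he1 : Real.exp (-1 / n) ≤ 1 := by
    rw [Real.exp_le_one_iff, neg_div]
    have : 0 ≤ 1 / (n:ℝ) := by positivity
    linarith
  have hc : 0 ≤ (1 - S) * f₀ x := mul_nonneg hS1.le (hf₀ x)
  simp only [fy, fyStar]
  rw [← hSdef, ← hρdef, ← ht, hρt]
  constructor
  · nlinarith [mul_le_mul_of_nonneg_left hup hc]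
  · have a1 := mul_le_mul_of_nonneg_left hlow hc
    have a2 := mul_le_mul_of_nonneg_right he1 hg
    linarith
end
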